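/- Assume LICQ holds on S and that f is bounded from below on S. Then f attains its infimum on S if and only if Σ(f,S) ≠ ∅ and min{f(x) : x ∈ Σ(f,S)} ≤ λ for every λ ∈ T_∞(f,S). -/

import Mathlib

open Filter

noncomputable section

def IsPolyFun {n : ℕ} (f : EuclideanSpace ℝ (Fin n) → ℝ) : Prop :=
  ∃ P : MvPolynomial (Fin n) ℝ, ∀ x, f x = MvPolynomial.eval (fun i => x i) P

def conSet {n l m : ℕ} (g : Fin l → EuclideanSpace ℝ (Fin n) → ℝ)
    (h : Fin m → EuclideanSpace ℝ (Fin n) → ℝ) : Set (EuclideanSpace ℝ (Fin n)) :=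
  {x | (∀ i, g i x = 0) ∧ (∀ j, 0 ≤ h j x)}

def LICQ {n l m : ℕ} (g : Fin l → EuclideanSpace ℝ (Fin n) → ℝ)
    (h : Fin m → EuclideanSpace ℝ (Fin n) → ℝ) : Prop :=
  ∀ x ∈ conSet g h, LinearIndependent ℝ
    (Sum.elim (fun i : Fin l => gradient (g i) x)
      (fun j : {j : Fin m // h j x = 0} => gradient (h j.1) x))

def criticalSet {n l m : ℕ} (f : EuclideanSpace ℝ (Fin n) → ℝ)
    (g : Fin l → EuclideanSpace ℝ (Fin n) → ℝ)
    (h : Fin m → EuclideanSpace ℝ (Fin n) → ℝ) : Set (EuclideanSpace ℝ (Fin n)) :=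
  {x | x ∈ conSet g h ∧ ∃ (lam : Fin l → ℝ) (nu : Fin m → ℝ),
    gradient f x - ∑ i, lam i • gradient (g i) x - ∑ j, nu j • gradient (h j) x = 0 ∧
    ∀ j, nu j * h j x = 0}

def tangencySet {n l m : ℕ} (f : EuclideanSpace ℝ (Fin n) → ℝ)
    (g : Fin l → EuclideanSpace ℝ (Fin n) → ℝ)
    (h : Fin m → EuclideanSpace ℝ (Fin n) → ℝ) : Set (EuclideanSpace ℝ (Fin n)) :=
  {x | x ∈ conSet g h ∧ ∃ (κ : ℝ) (lam : Fin l → ℝ) (nu : Fin m → ℝ) (μ : ℝ),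
    (κ, lam, nu, μ) ≠ 0 ∧
    κ • gradient f x - ∑ i, lam i • gradient (g i) x - ∑ j, nu j • gradient (h j) x - μ • x = 0 ∧
    ∀ j, nu j * h j x = 0}

def tangencyValues {n l m : ℕ} (f : EuclideanSpace ℝ (Fin n) → ℝ)
    (g : Fin l → EuclideanSpace ℝ (Fin n) → ℝ)
    (h : Fin m → EuclideanSpace ℝ (Fin n) → ℝ) : Set ℝ :=
  {lam | ∃ x : ℕ → EuclideanSpace ℝ (Fin n), (∀ k, x k ∈ tangencySet f g h) ∧
    Tendsto (fun k => ‖x k‖) atTop atTop ∧ Tendsto (fun k => f (x k)) atTop (nhds lam)}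

def psi {n l m : ℕ} (f : EuclideanSpace ℝ (Fin n) → ℝ)
    (g : Fin l → EuclideanSpace ℝ (Fin n) → ℝ)
    (h : Fin m → EuclideanSpace ℝ (Fin n) → ℝ) (t : ℝ) : EReal :=
  sInf ((fun x => (f x : EReal)) '' {x | x ∈ conSet g h ∧ ‖x‖ = t})

def CoerciveOn {n : ℕ} (f : EuclideanSpace ℝ (Fin n) → ℝ)
    (S : Set (EuclideanSpace ℝ (Fin n))) : Prop :=
  ∀ x : ℕ → EuclideanSpace ℝ (Fin n), (∀ k, x k ∈ S) →
    Tendsto (fun k => ‖x k‖) atTop atTop → Tendsto (fun k => f (x k)) atTop atTop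

universe u

theorem injective_mapBaseChange_of_formallySmooth (R S T : Type*) [CommRing R] [CommRing S]
    [CommRing T] [Algebra R S] [Algebra S T] [Algebra R T] [IsScalarTower R S T]
    [Algebra.FormallySmooth S T] :
    Function.Injective (KaehlerDifferential.mapBaseChange R S T) := by
  refine (injective_iff_map_eq_zero _).mpr fun x hx ↦ ?_
  obtain ⟨y, rfl⟩ := (Algebra.H1Cotangent.exact_δ_mapBaseChange R S T x).mp hx
  rw [Subsingleton.elim y 0, map_zero]

theorem D_ne_zero_of_transcendental {k K : Type*} [Field k] [CharZero k] [Field K] [Algebra k K]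
    [Algebra.EssFiniteType k K] {t : K} (ht : Transcendental k t) :
    KaehlerDifferential.D k K t ≠ 0 := by
  let : Algebra (Polynomial k) K := (Polynomial.aeval (R := k) t).toRingHom.toAlgebra
  have hinj : Function.Injective (algebraMap (Polynomial k) K) := transcendental_iff_injective.mp ht
  have : IsScalarTower k (Polynomial k) K :=
    .of_algebraMap_eq fun a ↦ (Polynomial.aeval_C t a).symm
  have : FaithfulSMul (Polynomial k) K := (faithfulSMul_iff_algebraMap_injective _ _).mpr hinj
  let := FractionRing.liftAlgebra (Polynomial k) K
  have : IsScalarTower k (FractionRing (Polynomial k)) K :=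
    .to₁₃₄ _ (Polynomial k) _ _
  have : CharZero (FractionRing (Polynomial k)) :=
    charZero_of_injective_algebraMap (algebraMap k (FractionRing (Polynomial k))).injective
  have : Algebra.EssFiniteType (FractionRing (Polynomial k)) K := .of_comp k _ _
  have : Algebra.FormallySmooth (Polynomial k) (FractionRing (Polynomial k)) :=
    .of_isLocalization (nonZeroDivisors (Polynomial k))
  have : Algebra.FormallySmooth (Polynomial k) K :=
    .comp _ (FractionRing (Polynomial k)) _
  intro h0
  have h1 : KaehlerDifferential.mapBaseChange k (Polynomial k) K
      (1 ⊗ₜ KaehlerDifferential.D k (Polynomial k) Polynomial.X) = 0 := by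
    rw [KaehlerDifferential.mapBaseChange_tmul, KaehlerDifferential.map_D, one_smul]
    have : algebraMap (Polynomial k) K Polynomial.X = t := Polynomial.aeval_X t
    rw [this, h0]
  have h2 := injective_mapBaseChange_of_formallySmooth k (Polynomial k) K (h1.trans (map_zero _).symm)
  have h3 := congrArg ((KaehlerDifferential.polynomialEquiv k).toLinearMap.baseChange K) h2
  rw [LinearMap.baseChange_tmul, map_zero] at h3
  have h4 := congrArg (TensorProduct.rid (Polynomial k) K) h3
  simp [KaehlerDifferential.polynomialEquiv_D] at h4

theorem derivation_aeval {k K M σ : Type*} [CommRing k] [CommRing K] [Algebra k K] [AddCommGroup M]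
    [Module k M] [Module K M] [IsScalarTower k K M] [Fintype σ] (D : Derivation k K M) (y : σ → K)
    (P : MvPolynomial σ k) :
    D (MvPolynomial.aeval y P) = ∑ i, MvPolynomial.aeval y (MvPolynomial.pderiv i P) • D (y i) := by
  classical
  induction P using MvPolynomial.induction_on with
  | C a => simp
  | add p q hp hq => simp [hp, hq, add_smul, Finset.sum_add_distrib]
  | mul_X p i hp =>
    simp [hp, add_smul, Finset.sum_add_distrib, MvPolynomial.pderiv_X, Finset.smul_sum, mul_smul,
      Pi.single_apply, smul_comm (y i), apply_ite, ite_smul]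

theorem exists_field_algHom_ker_eq {k : Type*} {R : Type u} [Field k] [CommRing R] [Algebra k R]
    [Algebra.FiniteType k R] (p : Ideal R) [p.IsPrime] :
    ∃ (K : Type u) (_ : Field K) (_ : Algebra k K) (_ : Algebra.EssFiniteType k K) (φ : R →ₐ[k] K),
      ∀ a, φ a = 0 ↔ a ∈ p := by
  have : Algebra.EssFiniteType (R ⧸ p) (FractionRing (R ⧸ p)) :=
    .of_isLocalization _ (nonZeroDivisors (R ⧸ p))
  refine ⟨FractionRing (R ⧸ p), inferInstance, inferInstance, .comp k (R ⧸ p) _,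
    (IsScalarTower.toAlgHom k (R ⧸ p) (FractionRing (R ⧸ p))).comp (Ideal.Quotient.mkₐ k p),
    fun a ↦ ?_⟩
  simp [Ideal.Quotient.eq_zero_iff_mem]

theorem exists_polynomial_mem_radical {k : Type*} {R : Type u} [Field k] [CharZero k] [CommRing R]
    [Algebra k R] [Algebra.FiniteType k R] (I : Ideal R) (F : R)
    (hD : ∀ (K : Type u) [Field K] [Algebra k K] (φ : R →ₐ[k] K), (∀ a ∈ I, φ a = 0) →
      KaehlerDifferential.D k K (φ F) = 0) :
    ∃ q : Polynomial k, q ≠ 0 ∧ Polynomial.aeval F q ∈ I.radical := by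
  have : IsNoetherianRing R := Algebra.FiniteType.isNoetherianRing k R
  have hfin := I.finite_minimalPrimes_of_isNoetherianRing R
  have key : ∀ p ∈ I.minimalPrimes, ∃ q : Polynomial k, q ≠ 0 ∧ Polynomial.aeval F q ∈ p := by
    intro p hp
    have : p.IsPrime := hp.1.1
    obtain ⟨K, _, _, _, φ, hφ⟩ := exists_field_algHom_ker_eq (k := k) p
    have halg : IsAlgebraic k (φ F) := by
      by_contra h
      exact D_ne_zero_of_transcendental h (hD K φ fun a ha ↦ (hφ a).mpr (hp.1.2 ha))
    obtain ⟨q, hq, hq0⟩ := halg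
    exact ⟨q, hq, (hφ _).mp ((Polynomial.aeval_algHom_apply φ F q).symm.trans hq0)⟩
  choose! q hq hqm using key
  refine ⟨∏ p ∈ hfin.toFinset, q p, Finset.prod_ne_zero_iff.mpr fun p hp ↦
    hq p (hfin.mem_toFinset.mp hp), ?_⟩
  rw [← Ideal.sInf_minimalPrimes, Ideal.mem_sInf]
  intro p hp
  rw [map_prod]
  exact p.mem_of_dvd (Finset.dvd_prod_of_mem _ (hfin.mem_toFinset.mpr hp)) (hqm p hp)

theorem finite_setOf_algHom_apply {k : Type*} {R : Type u} [Field k] [CharZero k] [CommRing R]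
    [Algebra k R] [Algebra.FiniteType k R] (s : Set R) (F : R)
    (hD : ∀ (K : Type u) [Field K] [Algebra k K] (φ : R →ₐ[k] K), (∀ a ∈ s, φ a = 0) →
      KaehlerDifferential.D k K (φ F) = 0) :
    {c : k | ∃ φ : R →ₐ[k] k, (∀ a ∈ s, φ a = 0) ∧ φ F = c}.Finite := by
  obtain ⟨q, hq, N, hN⟩ := exists_polynomial_mem_radical (Ideal.span s) F fun K _ _ φ hφ ↦
    hD K φ fun a ha ↦ hφ a (Ideal.subset_span ha)
  refine (Polynomial.finite_setOfPred_isRoot hq).subset ?_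
  rintro _ ⟨φ, hφ, rfl⟩
  have hle : Ideal.span s ≤ RingHom.ker φ := Ideal.span_le.mpr hφ
  have h : φ (Polynomial.aeval F q ^ N) = 0 := hle hN
  rw [map_pow, ← Polynomial.aeval_algHom_apply] at h
  simpa [Polynomial.aeval_def, Polynomial.IsRoot] using eq_zero_of_pow_eq_zero h

section GradientOfPolynomial

variable {n : ℕ} {f : EuclideanSpace ℝ (Fin n) → ℝ}

theorem hasFDerivAt_eval (P : MvPolynomial (Fin n) ℝ) (x : EuclideanSpace ℝ (Fin n)) :
    HasFDerivAt (fun y : EuclideanSpace ℝ (Fin n) ↦ MvPolynomial.eval (fun i ↦ y i) P)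
      (∑ i, MvPolynomial.eval (fun i ↦ x i) (MvPolynomial.pderiv i P) •
        (EuclideanSpace.proj i : EuclideanSpace ℝ (Fin n) →L[ℝ] ℝ)) x := by
  classical
  induction P using MvPolynomial.induction_on with
  | C a => simpa using hasFDerivAt_const a x
  | add p q hp hq => simpa [add_smul, Finset.sum_add_distrib] using hp.fun_add hq
  | mul_X p i hp =>
    have hX : HasFDerivAt (fun y : EuclideanSpace ℝ (Fin n) ↦ y i)
        (EuclideanSpace.proj i : EuclideanSpace ℝ (Fin n) →L[ℝ] ℝ) x :=
      (EuclideanSpace.proj i : EuclideanSpace ℝ (Fin n) →L[ℝ] ℝ).hasFDerivAt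
    simp only [map_mul, MvPolynomial.eval_X]
    refine (hp.fun_mul hX).congr_fderiv ?_
    simp [add_smul, Finset.sum_add_distrib, MvPolynomial.pderiv_X, Finset.smul_sum, mul_smul,
      Pi.single_apply, smul_comm (x i), apply_ite, ite_smul]

theorem gradient_apply_of_eval {P : MvPolynomial (Fin n) ℝ}
    (hP : ∀ x, f x = MvPolynomial.eval (fun i ↦ x i) P) (x : EuclideanSpace ℝ (Fin n))
    (i : Fin n) : gradient f x i = MvPolynomial.eval (fun i ↦ x i) (MvPolynomial.pderiv i P) := by
  classical
  have hf : f = fun y : EuclideanSpace ℝ (Fin n) ↦ MvPolynomial.eval (fun i ↦ y i) P := funext hP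
  have h : inner ℝ (gradient f x) (EuclideanSpace.single i 1) =
      fderiv ℝ f x (EuclideanSpace.single i 1) := by
    simp [gradient]
  rw [EuclideanSpace.inner_single_right] at h
  rw [hf, (hasFDerivAt_eval P x).fderiv] at h
  rw [hf]
  simpa [Pi.single_apply] using h

theorem IsPolyFun.contDiff (hf : IsPolyFun f) : ContDiff ℝ 1 f := by
  obtain ⟨P, hP⟩ := hf
  rw [funext hP]
  induction P using MvPolynomial.induction_on generalizing f with
  | C a => simpa using contDiff_const
  | add p q hp hq =>
    simpa using (hp (f := fun _ ↦ _) fun _ ↦ rfl).add (hq (f := fun _ ↦ _) fun _ ↦ rfl)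
  | mul_X p i hp =>
    simpa using (hp (f := fun _ ↦ _) fun _ ↦ rfl).mul
      (EuclideanSpace.proj i : EuclideanSpace ℝ (Fin n) →L[ℝ] ℝ).contDiff

end GradientOfPolynomial

theorem finite_image_criticalSet {n l m : ℕ} {f : EuclideanSpace ℝ (Fin n) → ℝ}
    {g : Fin l → EuclideanSpace ℝ (Fin n) → ℝ} {h : Fin m → EuclideanSpace ℝ (Fin n) → ℝ}
    (hf : IsPolyFun f) (hg : ∀ i, IsPolyFun (g i)) (hh : ∀ j, IsPolyFun (h j)) :
    (f '' criticalSet f g h).Finite := by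
  obtain ⟨P, hP⟩ := hf
  choose G hG using hg
  choose H hH using hh
  let ι : MvPolynomial (Fin n) ℝ →ₐ[ℝ] MvPolynomial (Fin n ⊕ Fin l ⊕ Fin m) ℝ :=
    MvPolynomial.rename Sum.inl
  let lam (a : Fin l) : MvPolynomial (Fin n ⊕ Fin l ⊕ Fin m) ℝ := .X (.inr (.inl a))
  let nu (b : Fin m) : MvPolynomial (Fin n ⊕ Fin l ⊕ Fin m) ℝ := .X (.inr (.inr b))
  let s : Set (MvPolynomial (Fin n ⊕ Fin l ⊕ Fin m) ℝ) :=
    (Set.range fun i ↦ ι (MvPolynomial.pderiv i P) - ∑ a, lam a * ι (MvPolynomial.pderiv i (G a)) -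
      ∑ b, nu b * ι (MvPolynomial.pderiv i (H b))) ∪
    (Set.range fun a ↦ ι (G a)) ∪ Set.range fun b ↦ nu b * ι (H b)
  refine (finite_setOf_algHom_apply s (ι P) ?_).subset ?_
  · intro K _ _ φ hφ
    have hι (p : MvPolynomial (Fin n) ℝ) :
        φ (ι p) = MvPolynomial.aeval (fun i ↦ φ (.X (.inl i))) p := by
      have := MvPolynomial.aeval_unique (φ.comp ι)
      simpa [ι, Function.comp_def] using congrArg (fun ψ ↦ ψ p) this
    set y : Fin n → K := fun i ↦ φ (.X (.inl i))
    have hcrit (i : Fin n) : MvPolynomial.aeval y (MvPolynomial.pderiv i P) =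
        ∑ a, φ (lam a) * MvPolynomial.aeval y (MvPolynomial.pderiv i (G a)) +
        ∑ b, φ (nu b) * MvPolynomial.aeval y (MvPolynomial.pderiv i (H b)) := by
      have := hφ _ (.inl (.inl ⟨i, rfl⟩))
      simp only [map_sub, map_sum, map_mul, hι] at this
      linear_combination this
    have hGy (a : Fin l) : MvPolynomial.aeval y (G a) = 0 := by
      rw [← hι]; exact hφ _ (.inl (.inr ⟨a, rfl⟩))
    have hHy (b : Fin m) : φ (nu b) * MvPolynomial.aeval y (H b) = 0 := by
      rw [← hι, ← map_mul]; exact hφ _ (.inr ⟨b, rfl⟩)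
    have hDG (a : Fin l) : φ (lam a) • KaehlerDifferential.D ℝ K (MvPolynomial.aeval y (G a)) = 0 := by
      rw [hGy, map_zero, smul_zero]
    have hDH (b : Fin m) : φ (nu b) • KaehlerDifferential.D ℝ K (MvPolynomial.aeval y (H b)) = 0 := by
      rcases mul_eq_zero.mp (hHy b) with hb | hb <;> simp [hb]
    simp only [derivation_aeval, Finset.smul_sum, smul_smul] at hDG hDH
    rw [hι, derivation_aeval]
    simp only [hcrit, add_smul, Finset.sum_smul, Finset.sum_add_distrib]
    rw [Finset.sum_comm, Finset.sum_eq_zero fun a _ ↦ hDG a, Finset.sum_comm,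
      Finset.sum_eq_zero fun b _ ↦ hDH b, add_zero]
  · rintro _ ⟨x, ⟨hx, u, v, hgrad, hcompl⟩, rfl⟩
    let z : Fin n ⊕ Fin l ⊕ Fin m → ℝ := Sum.elim (fun i ↦ x i) (Sum.elim u v)
    have hι (p : MvPolynomial (Fin n) ℝ) :
        MvPolynomial.aeval z (ι p) = MvPolynomial.eval (fun i ↦ x i) p := by
      simp only [ι, MvPolynomial.aeval_rename, MvPolynomial.aeval_eq_eval]
      rfl
    have hlam (a : Fin l) : MvPolynomial.aeval z (lam a) = u a := by simp [lam, z]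
    have hnu (b : Fin m) : MvPolynomial.aeval z (nu b) = v b := by simp [nu, z]
    refine ⟨MvPolynomial.aeval z, ?_, by rw [hι, hP]⟩
    rintro _ ((⟨i, rfl⟩ | ⟨a, rfl⟩) | ⟨b, rfl⟩)
    · have := congrArg (fun w : EuclideanSpace ℝ (Fin n) ↦ w i) hgrad
      simp only [map_sub, map_sum, map_mul, hι, hlam, hnu]
      simpa [gradient_apply_of_eval hP, gradient_apply_of_eval (hG _),
        gradient_apply_of_eval (hH _)] using this
    · simp only [hι, ← hG]; exact hx.1 a
    · simp only [map_mul, hι, hnu, ← hH]; exact hcompl b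

theorem ContDiff.hasStrictFDerivAt_toDual_gradient {E : Type*} [NormedAddCommGroup E]
    [InnerProductSpace ℝ E] [CompleteSpace E] {f : E → ℝ} (hf : ContDiff ℝ 1 f) (x : E) :
    HasStrictFDerivAt f (InnerProductSpace.toDual ℝ E (gradient f x)) x := by
  simpa [gradient] using hf.contDiffAt.hasStrictFDerivAt one_ne_zero

theorem IsLocalMinOn.exists_multipliers_gradient {E ι : Type*} [Fintype ι] [NormedAddCommGroup E]
    [InnerProductSpace ℝ E] [CompleteSpace E] {f : E → ℝ} {F : ι → E → ℝ} {x : E}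
    (hf : ContDiff ℝ 1 f) (hF : ∀ i, ContDiff ℝ 1 (F i))
    (hmin : IsLocalMinOn f {y | ∀ i, F i y = F i x} x) :
    ∃ (Λ : ι → ℝ) (κ : ℝ), (Λ, κ) ≠ 0 ∧ ∑ i, Λ i • gradient (F i) x + κ • gradient f x = 0 := by
  obtain ⟨Λ, κ, hne, heq⟩ := IsLocalExtrOn.exists_multipliers_of_hasStrictFDerivAt (.inl hmin)
    (fun i ↦ (hF i).hasStrictFDerivAt_toDual_gradient x) (hf.hasStrictFDerivAt_toDual_gradient x)
  refine ⟨Λ, κ, hne, (InnerProductSpace.toDual ℝ E).injective ?_⟩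
  simpa using heq

theorem sum_subtype_eq_sum {ι M : Type*} [Fintype ι] [AddCommMonoid M] {p : ι → Prop}
    [DecidablePred p] {f : ι → M} (hf : ∀ i, ¬ p i → f i = 0) : ∑ i : {i // p i}, f i = ∑ i, f i :=
  Fintype.sum_of_injective Subtype.val Subtype.val_injective _ _
    (fun i hi ↦ hf i fun hp ↦ hi ⟨⟨i, hp⟩, rfl⟩) fun _ ↦ rfl

section Multipliers

variable {n l m : ℕ} {f : EuclideanSpace ℝ (Fin n) → ℝ} {g : Fin l → EuclideanSpace ℝ (Fin n) → ℝ}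
  {h : Fin m → EuclideanSpace ℝ (Fin n) → ℝ}

theorem exists_fritzJohn_multipliers {r : ℕ} {ψ : Fin r → EuclideanSpace ℝ (Fin n) → ℝ}
    {x : EuclideanSpace ℝ (Fin n)} (hf : ContDiff ℝ 1 f) (hg : ∀ i, ContDiff ℝ 1 (g i))
    (hh : ∀ j, ContDiff ℝ 1 (h j)) (hψ : ∀ c, ContDiff ℝ 1 (ψ c)) (hx : x ∈ conSet g h)
    (hmin : ∀ y ∈ conSet g h, (∀ c, ψ c y = ψ c x) → f x ≤ f y) :
    ∃ (κ : ℝ) (lam : Fin l → ℝ) (nu : Fin m → ℝ) (μ : Fin r → ℝ), (κ, lam, nu, μ) ≠ 0 ∧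
      κ • gradient f x - ∑ i, lam i • gradient (g i) x - ∑ j, nu j • gradient (h j) x -
        ∑ c, μ c • gradient (ψ c) x = 0 ∧
      ∀ j, h j x ≠ 0 → nu j = 0 := by
  classical
  let F : Fin l ⊕ {j // h j x = 0} ⊕ Fin r → EuclideanSpace ℝ (Fin n) → ℝ :=
    Sum.elim g (Sum.elim (fun j ↦ h j.1) ψ)
  have hF : ∀ i, ContDiff ℝ 1 (F i) := by
    rintro (i | j | c)
    exacts [hg i, hh j, hψ c]
  have hloc : IsLocalMinOn f {y | ∀ i, F i y = F i x} x := by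
    have hpos : ∀ᶠ y in nhds x, ∀ j, h j x ≠ 0 → 0 < h j y :=
      eventually_all.mpr fun j ↦ by
        by_cases hj : h j x = 0
        · simp [hj]
        · filter_upwards [(hh j).continuous.continuousAt.eventually
            (lt_mem_nhds (lt_of_le_of_ne (hx.2 j) (Ne.symm hj)))] with y hy _ using hy
    filter_upwards [mem_nhdsWithin_of_mem_nhds hpos, self_mem_nhdsWithin] with y hy hyF
    refine hmin y ⟨fun i ↦ (hyF (.inl i)).trans (hx.1 i), fun j ↦ ?_⟩ fun c ↦ hyF (.inr (.inr c))
    by_cases hj : h j x = 0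
    · exact ((hyF (.inr (.inl ⟨j, hj⟩))).trans hj).ge
    · exact (hy j hj).le
  obtain ⟨Λ, κ, hne, heq⟩ := hloc.exists_multipliers_gradient hf hF
  refine ⟨κ, fun i ↦ -Λ (.inl i), fun j ↦ if hj : h j x = 0 then -Λ (.inr (.inl ⟨j, hj⟩)) else 0,
    fun c ↦ -Λ (.inr (.inr c)), ?_, ?_, fun j hj ↦ dif_neg hj⟩
  · contrapose! hne
    simp only [Prod.mk_eq_zero, funext_iff, Pi.zero_apply, neg_eq_zero] at hne ⊢
    obtain ⟨hκ, hl, hn, hm⟩ := hne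
    refine ⟨?_, hκ⟩
    rintro (i | ⟨j, hj⟩ | c)
    · exact hl i
    · simpa [hj] using hn j
    · exact hm c
  · have hsum : ∑ j, (if hj : h j x = 0 then -Λ (.inr (.inl ⟨j, hj⟩)) else 0) • gradient (h j) x =
        -∑ j : {j // h j x = 0}, Λ (.inr (.inl j)) • gradient (h j) x := by
      rw [← Finset.sum_neg_distrib, ← sum_subtype_eq_sum fun j hj ↦ by rw [dif_neg hj, zero_smul]]
      exact Finset.sum_congr rfl fun j _ ↦ by rw [dif_pos j.2, neg_smul]
    rw [hsum, ← heq]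
    simp only [F, Fintype.sum_sum_type, Sum.elim_inl, Sum.elim_inr, neg_smul,
      Finset.sum_neg_distrib]
    abel

theorem mem_criticalSet_of_isMinOn {x : EuclideanSpace ℝ (Fin n)} (hf : ContDiff ℝ 1 f)
    (hg : ∀ i, ContDiff ℝ 1 (g i)) (hh : ∀ j, ContDiff ℝ 1 (h j)) (hlicq : LICQ g h)
    (hx : x ∈ conSet g h) (hmin : ∀ y ∈ conSet g h, f x ≤ f y) : x ∈ criticalSet f g h := by
  obtain ⟨κ, lam, nu, μ, hne, heq, hnu⟩ := exists_fritzJohn_multipliers (ψ := Fin.elim0) hf hg hh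
    (fun c ↦ c.elim0) hx fun y hy _ ↦ hmin y hy
  have hκ : κ ≠ 0 := by
    rintro rfl
    have hsum : ∑ k, Sum.elim lam (fun j : {j // h j x = 0} ↦ nu j.1) k •
        Sum.elim (fun i ↦ gradient (g i) x) (fun j : {j // h j x = 0} ↦ gradient (h j.1) x) k =
        0 := by
      rw [Fintype.sum_sum_type]
      simp only [Sum.elim_inl, Sum.elim_inr]
      rw [sum_subtype_eq_sum (f := fun j ↦ nu j • gradient (h j) x) fun j hj ↦ by
        rw [hnu j hj, zero_smul], ← neg_eq_zero, ← heq]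
      simp only [zero_smul, Fintype.sum_empty]
      abel
    have hzero := Fintype.linearIndependent_iff.mp (hlicq x hx) _ hsum
    refine hne ?_
    simp only [Prod.mk_eq_zero, funext_iff, Pi.zero_apply, true_and]
    refine ⟨fun i ↦ hzero (.inl i), fun j ↦ ?_, fun c ↦ c.elim0⟩
    by_cases hj : h j x = 0
    · exact hzero (.inr ⟨j, hj⟩)
    · exact hnu j hj
  refine ⟨hx, fun i ↦ κ⁻¹ * lam i, fun j ↦ κ⁻¹ * nu j, ?_, fun j ↦ ?_⟩
  · have := congrArg (κ⁻¹ • ·) heq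
    simpa [smul_sub, smul_smul, hκ, Finset.smul_sum] using this
  · by_cases hj : h j x = 0
    · simp [hj]
    · simp [hnu j hj]

theorem mem_tangencySet_of_isMinOn_sphere {x : EuclideanSpace ℝ (Fin n)} (hf : ContDiff ℝ 1 f)
    (hg : ∀ i, ContDiff ℝ 1 (g i)) (hh : ∀ j, ContDiff ℝ 1 (h j)) (hx : x ∈ conSet g h)
    (hmin : ∀ y ∈ conSet g h, ‖y‖ = ‖x‖ → f x ≤ f y) : x ∈ tangencySet f g h := by
  obtain ⟨κ, lam, nu, μ, hne, heq, hnu⟩ := exists_fritzJohn_multipliers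
    (ψ := fun _ : Fin 1 ↦ fun y ↦ ‖y‖ ^ 2) hf hg hh (fun _ ↦ contDiff_norm_sq ℝ) hx
    fun y hy hyx ↦ hmin y hy (by simpa using hyx 0)
  have hgrad : gradient (fun y : EuclideanSpace ℝ (Fin n) ↦ ‖y‖ ^ 2) x = (2 : ℝ) • x := by
    refine HasGradientAt.gradient ?_
    rw [hasGradientAt_iff_hasFDerivAt]
    refine (hasStrictFDerivAt_norm_sq x).hasFDerivAt.congr_fderiv ?_
    ext y
    simp
  refine ⟨hx, κ, lam, nu, 2 * μ 0, ?_, ?_, fun j ↦ ?_⟩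
  · contrapose! hne
    simpa [funext_iff] using hne
  · simpa [hgrad, smul_smul, mul_comm] using heq
  · by_cases hj : h j x = 0
    · simp [hj]
    · simp [hnu j hj]

theorem isClosed_conSet (hg : ∀ i, Continuous (g i)) (hh : ∀ j, Continuous (h j)) :
    IsClosed (conSet g h) := by
  simp only [conSet, Set.ofPred_and, Set.ofPred_forall]
  exact (isClosed_iInter fun i ↦ isClosed_eq (hg i) continuous_const).inter
    (isClosed_iInter fun j ↦ isClosed_le continuous_const (hh j))

theorem exists_mem_tangencySet_lt (hf : ContDiff ℝ 1 f) (hg : ∀ i, ContDiff ℝ 1 (g i))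
    (hh : ∀ j, ContDiff ℝ 1 (h j)) (hS : (conSet g h).Nonempty)
    (hbdd : BddBelow (f '' conSet g h)) (hna : ¬ ∃ x ∈ conSet g h, ∀ y ∈ conSet g h, f x ≤ f y)
    (R : ℝ) {a : ℝ} (ha : sInf (f '' conSet g h) < a) :
    ∃ x ∈ tangencySet f g h, R < ‖x‖ ∧ f x < a := by
  have hclosed := isClosed_conSet (fun i ↦ (hg i).continuous) fun j ↦ (hh j).continuous
  have hle : ∀ y ∈ conSet g h, sInf (f '' conSet g h) ≤ f y :=
    fun y hy ↦ csInf_le hbdd ⟨y, hy, rfl⟩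
  obtain ⟨y, hy, hRy, hya⟩ : ∃ y ∈ conSet g h, R < ‖y‖ ∧ f y < a := by
    by_contra! hcon
    have hcpt : IsCompact (conSet g h ∩ Metric.closedBall 0 R) :=
      (isCompact_closedBall 0 R).inter_left hclosed
    obtain ⟨_, ⟨y, hy, rfl⟩, hya⟩ := exists_lt_of_csInf_lt (hS.image f) ha
    have hyR : ‖y‖ ≤ R := by
      by_contra! hRy
      exact (hcon y hy hRy).not_gt hya
    obtain ⟨z, hz, hzmin⟩ := hcpt.exists_isMinOn ⟨y, hy, by simpa using hyR⟩
      hf.continuous.continuousOn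
    refine hna ⟨z, hz.1, fun w hw ↦ ?_⟩
    rcases le_or_gt ‖w‖ R with hwR | hwR
    · exact hzmin ⟨hw, by simpa using hwR⟩
    · exact ((hzmin ⟨hy, by simpa using hyR⟩).trans hya.le).trans (hcon w hw hwR)
  have hcpt : IsCompact (conSet g h ∩ Metric.sphere 0 ‖y‖) :=
    (isCompact_sphere 0 ‖y‖).inter_left hclosed
  obtain ⟨x, hx, hxmin⟩ := hcpt.exists_isMinOn ⟨y, hy, by simp⟩ hf.continuous.continuousOn
  have hxy : ‖x‖ = ‖y‖ := by simpa using hx.2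
  exact ⟨x, mem_tangencySet_of_isMinOn_sphere hf hg hh hx.1
    fun w hw hwx ↦ hxmin ⟨hw, by simpa [hxy] using hwx⟩, hxy ▸ hRy,
    (hxmin ⟨hy, by simp⟩).trans_lt hya⟩

theorem sInf_image_conSet_mem_tangencyValues (hf : ContDiff ℝ 1 f) (hg : ∀ i, ContDiff ℝ 1 (g i))
    (hh : ∀ j, ContDiff ℝ 1 (h j)) (hS : (conSet g h).Nonempty)
    (hbdd : BddBelow (f '' conSet g h))
    (hna : ¬ ∃ x ∈ conSet g h, ∀ y ∈ conSet g h, f x ≤ f y) :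
    sInf (f '' conSet g h) ∈ tangencyValues f g h := by
  choose x hxT hxn hxf using fun k : ℕ ↦ exists_mem_tangencySet_lt hf hg hh hS hbdd hna k
    (lt_add_of_pos_right (sInf (f '' conSet g h)) (Nat.one_div_pos_of_nat (n := k) (α := ℝ)))
  refine ⟨x, hxT, tendsto_atTop_mono (fun k ↦ (hxn k).le) tendsto_natCast_atTop_atTop,
    tendsto_of_tendsto_of_tendsto_of_le_of_le tendsto_const_nhds ?_
      (fun k ↦ csInf_le hbdd ⟨x k, (hxT k).1, rfl⟩) fun k ↦ (hxf k).le⟩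
  simpa using tendsto_const_nhds.add (tendsto_one_div_add_atTop_nhds_zero_nat (𝕜 := ℝ))

end Multipliers

theorem attains_inf_iff_tangency_values {n l m : ℕ} (f : EuclideanSpace ℝ (Fin n) → ℝ)
    (g : Fin l → EuclideanSpace ℝ (Fin n) → ℝ) (h : Fin m → EuclideanSpace ℝ (Fin n) → ℝ)
    (hf : IsPolyFun f) (hg : ∀ i, IsPolyFun (g i)) (hh : ∀ j, IsPolyFun (h j))
    (hS : (conSet g h).Nonempty) (hSu : ¬ Bornology.IsBounded (conSet g h))
    (hlicq : LICQ g h) (hbdd : BddBelow (f '' conSet g h)) :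
    (∃ x ∈ conSet g h, ∀ y ∈ conSet g h, f x ≤ f y) ↔
      ((criticalSet f g h).Nonempty ∧
        ∀ lam ∈ tangencyValues f g h, sInf (f '' criticalSet f g h) ≤ lam) := by
  have hsub : criticalSet f g h ⊆ conSet g h := fun x hx ↦ hx.1
  constructor
  · rintro ⟨x, hx, hmin⟩
    have hxc := mem_criticalSet_of_isMinOn hf.contDiff (fun i ↦ (hg i).contDiff)
      (fun j ↦ (hh j).contDiff) hlicq hx hmin
    refine ⟨⟨x, hxc⟩, ?_⟩
    rintro lam ⟨u, hu, -, hlim⟩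
    exact (csInf_le (hbdd.mono (Set.image_mono hsub)) ⟨x, hxc, rfl⟩).trans
      (ge_of_tendsto' hlim fun k ↦ hmin _ (hu k).1)
  · rintro ⟨hne, hle⟩
    by_contra hna
    have hm := hle _ (sInf_image_conSet_mem_tangencyValues hf.contDiff
      (fun i ↦ (hg i).contDiff) (fun j ↦ (hh j).contDiff) hS hbdd hna)
    obtain ⟨x, hx, hfx⟩ := (hne.image f).csInf_mem (finite_image_criticalSet hf hg hh)
    exact hna ⟨x, hsub hx, fun y hy ↦ (hfx.trans_le hm).trans (csInf_le hbdd ⟨y, hy, rfl⟩)⟩
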